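/- arXiv:1606.06593 — 4 statements merged into one kernel-verified Lean document; each statement's English description precedes it below -/
import Mathlib

section
/- Let D and A be real n×n matrices such that D, D − A, and D − A D^{−1} A are all invertible. Then (D − A)^{−1} = (1/2) [ D^{−1} + (I + D^{−1} A)(D − A D^{−1} A)^{−1}(I + A D^{−1}) ]. -/
open Matrix

theorem peng_spielman_splitting
    {n : ℕ} (D A : Matrix (Fin n) (Fin n) ℝ)
    (hD : IsUnit D) (hDA : IsUnit (D - A)) (hS : IsUnit (D - A * D⁻¹ * A)) :
    (D - A)⁻¹
      = (1 / 2 : ℝ) •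
          (D⁻¹ + (1 + D⁻¹ * A) * (D - A * D⁻¹ * A)⁻¹ * (1 + A * D⁻¹)) := by
  have hDD : D * D⁻¹ = 1 := mul_nonsing_inv D ((isUnit_iff_isUnit_det D).1 hD)
  have hSS : (D - A * D⁻¹ * A) * (D - A * D⁻¹ * A)⁻¹ = 1 :=
    mul_nonsing_inv _ ((isUnit_iff_isUnit_det _).1 hS)
  have factor : (D - A) * (1 + D⁻¹ * A) = D - A * D⁻¹ * A := by
    rw [sub_mul, mul_add, mul_add, ← mul_assoc D, hDD, ← mul_assoc A]
    noncomm_ring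
  apply inv_eq_right_inv
  rw [mul_smul_comm, mul_add, ← mul_assoc, ← mul_assoc, factor, hSS, one_mul, sub_mul, hDD,
    sub_add_add_cancel, ← two_smul ℝ (1 : Matrix (Fin n) (Fin n) ℝ), smul_smul]
  norm_num
end

section
/- Let M be a real symmetric positive semidefinite N×N matrix with M ⪯ μ_n I and M² ⪰ μ₂ M for constants μ_n ≥ μ₂ > 0, let A be a real symmetric N×N matrix with γI ⪯ A ⪯ ΓI for constants Γ ≥ γ > 0, and set H = M A^{−1} M. Suppose d*, d̂, z*, z̃ ∈ ℝ^N satisfy M d* = A z*, M d̂ = A z̃, and ‖z̃ − z*‖_M ≤ ε₀ ‖z*‖_M for some ε₀ ≥ 0. Then ‖d̂ − d*‖_H ≤ ε₀ (μ_n/μ₂) √(Γ/γ) · ‖d*‖_H. -/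
open Matrix

/-- The `P`-seminorm `‖v‖_P = √(vᵀ P v)` associated to a positive semidefinite matrix `P`. -/
noncomputable def mnorm {ι : Type*} [Fintype ι] (P : Matrix ι ι ℝ) (v : ι → ℝ) : ℝ :=
  Real.sqrt (v ⬝ᵥ P.mulVec v)

namespace Matrix

theorem PosSemidef.isSymm_real {ι : Type*} {P : Matrix ι ι ℝ} (hP : P.PosSemidef) : P.IsSymm := by
  simpa [IsHermitian, IsSymm, conjTranspose_eq_transpose_of_trivial] using hP.isHermitian

variable {ι : Type*} [Fintype ι]

theorem PosSemidef.dotProduct_mulVec_nonneg_real {P : Matrix ι ι ℝ} (hP : P.PosSemidef)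
    (x : ι → ℝ) : 0 ≤ x ⬝ᵥ P.mulVec x := by
  simpa using hP.dotProduct_mulVec_nonneg x

theorem IsSymm.dotProduct_mulVec_comm {P : Matrix ι ι ℝ} (hP : P.IsSymm) (x y : ι → ℝ) :
    x ⬝ᵥ P.mulVec y = y ⬝ᵥ P.mulVec x := by
  rw [dotProduct_mulVec, ← mulVec_transpose, hP.eq, dotProduct_comm]

/-- The Cauchy–Schwarz inequality for a positive semidefinite form. -/
theorem PosSemidef.sq_dotProduct_mulVec_le {P : Matrix ι ι ℝ} (hP : P.PosSemidef)
    (x y : ι → ℝ) :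
    (x ⬝ᵥ P.mulVec y) ^ 2 ≤ (x ⬝ᵥ P.mulVec x) * (y ⬝ᵥ P.mulVec y) := by
  have h : ∀ t : ℝ, 0 ≤ (y ⬝ᵥ P.mulVec y) * (t * t) + (2 * (x ⬝ᵥ P.mulVec y)) * t
      + x ⬝ᵥ P.mulVec x := by
    intro t
    have h := hP.dotProduct_mulVec_nonneg_real (x + t • y)
    simp only [mulVec_add, mulVec_smul, dotProduct_add, add_dotProduct, dotProduct_smul,
      smul_dotProduct, smul_eq_mul, hP.isSymm_real.dotProduct_mulVec_comm y x] at h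
    linarith
  have := discrim_le_zero h
  rw [discrim] at this
  linarith

variable [DecidableEq ι]

theorem PosSemidef.dotProduct_mulVec_le_smul {P : Matrix ι ι ℝ} {c : ℝ}
    (h : (c • (1 : Matrix ι ι ℝ) - P).PosSemidef) (x : ι → ℝ) :
    x ⬝ᵥ P.mulVec x ≤ c * (x ⬝ᵥ x) := by
  have := h.dotProduct_mulVec_nonneg_real x
  simp only [sub_mulVec, smul_mulVec, one_mulVec, dotProduct_sub, dotProduct_smul,
    smul_eq_mul] at this
  linarith

theorem PosSemidef.smul_le_dotProduct_mulVec {P : Matrix ι ι ℝ} {c : ℝ}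
    (h : (P - c • (1 : Matrix ι ι ℝ)).PosSemidef) (x : ι → ℝ) :
    c * (x ⬝ᵥ x) ≤ x ⬝ᵥ P.mulVec x := by
  have := h.dotProduct_mulVec_nonneg_real x
  simp only [sub_mulVec, smul_mulVec, one_mulVec, dotProduct_sub, dotProduct_smul,
    smul_eq_mul] at this
  linarith

/-- If `0 ⪯ P ⪯ c I` then `P² ⪯ c P`. -/
theorem PosSemidef.mulVec_dotProduct_mulVec_le {P : Matrix ι ι ℝ} {c : ℝ} (hP : P.PosSemidef)
    (hc : 0 ≤ c) (h : (c • (1 : Matrix ι ι ℝ) - P).PosSemidef) (x : ι → ℝ) :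
    P.mulVec x ⬝ᵥ P.mulVec x ≤ c * (x ⬝ᵥ P.mulVec x) := by
  have hx := hP.dotProduct_mulVec_nonneg_real x
  have hcs := hP.sq_dotProduct_mulVec_le (P.mulVec x) x
  have hub := PosSemidef.dotProduct_mulVec_le_smul h (P.mulVec x)
  rcases (show 0 ≤ P.mulVec x ⬝ᵥ P.mulVec x from
    Finset.sum_nonneg fun _ _ => mul_self_nonneg _).eq_or_lt with h0 | h0
  · rw [← h0]
    positivity
  · refine le_of_mul_le_mul_left ?_ h0
    nlinarith [mul_le_mul_of_nonneg_right hub hx]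

theorem dotProduct_mul_inv_mul_mulVec {M A : Matrix ι ι ℝ} (hM : M.IsSymm)
    (hdet : IsUnit A.det) {d z : ι → ℝ} (h : M.mulVec d = A.mulVec z) :
    d ⬝ᵥ (M * A⁻¹ * M).mulVec d = z ⬝ᵥ A.mulVec z := by
  have h' : A⁻¹.mulVec (M.mulVec d) = z := by
    rw [h, mulVec_mulVec, nonsing_inv_mul A hdet, one_mulVec]
  rw [← mulVec_mulVec, ← mulVec_mulVec, h', hM.dotProduct_mulVec_comm, h]

theorem PosSemidef.mul_dotProduct_mulVec_le_of_mulVec_eq {M A : Matrix ι ι ℝ} {μ Γ : ℝ}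
    (hM : M.PosSemidef) (hμ : 0 ≤ μ) (hM2 : (M * M - μ • M).PosSemidef)
    (hA : A.PosSemidef) (hΓ : 0 ≤ Γ) (hAub : (Γ • (1 : Matrix ι ι ℝ) - A).PosSemidef)
    {w e : ι → ℝ} (h : M.mulVec w = A.mulVec e) :
    μ * (e ⬝ᵥ A.mulVec e) ≤ Γ * (e ⬝ᵥ M.mulVec e) := by
  have hcs := hM.sq_dotProduct_mulVec_le e w
  have hew : e ⬝ᵥ M.mulVec w = e ⬝ᵥ A.mulVec e := by rw [h]
  rw [hew] at hcs
  have hn := hA.mulVec_dotProduct_mulVec_le hΓ hAub e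
  have hm := hM.dotProduct_mulVec_nonneg_real e
  have hp : μ * (w ⬝ᵥ M.mulVec w) ≤ A.mulVec e ⬝ᵥ A.mulVec e := by
    have h2 := hM2.dotProduct_mulVec_nonneg_real w
    simp only [sub_mulVec, smul_mulVec, ← mulVec_mulVec, dotProduct_sub, dotProduct_smul,
      smul_eq_mul] at h2
    rw [hM.isSymm_real.dotProduct_mulVec_comm w (M.mulVec w)] at h2
    rw [← h]
    linarith
  rcases (hA.dotProduct_mulVec_nonneg_real e).eq_or_lt with h0 | h0
  · rw [← h0, mul_zero]
    positivity
  · refine le_of_mul_le_mul_left ?_ h0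
    nlinarith [mul_le_mul_of_nonneg_left hcs hμ,
      mul_le_mul_of_nonneg_left (hp.trans hn) hm]

end Matrix

theorem first_stage_approximation_bound
    {N : ℕ} (M A : Matrix (Fin N) (Fin N) ℝ) (μn μ₂ γ Γ ε₀ : ℝ)
    (hμ₂ : 0 < μ₂) (hμ : μ₂ ≤ μn) (hγ : 0 < γ) (hΓ : γ ≤ Γ) (hε₀ : 0 ≤ ε₀)
    (hM : M.PosSemidef)
    (hMub : (μn • (1 : Matrix (Fin N) (Fin N) ℝ) - M).PosSemidef)
    (hM2 : (M * M - μ₂ • M).PosSemidef)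
    (hA : A.IsSymm)
    (hAlb : (A - γ • (1 : Matrix (Fin N) (Fin N) ℝ)).PosSemidef)
    (hAub : (Γ • (1 : Matrix (Fin N) (Fin N) ℝ) - A).PosSemidef)
    (ds dh zs zt : Fin N → ℝ)
    (hds : M.mulVec ds = A.mulVec zs)
    (hdh : M.mulVec dh = A.mulVec zt)
    (hz : mnorm M (zt - zs) ≤ ε₀ * mnorm M zs) :
    mnorm (M * A⁻¹ * M) (dh - ds)
      ≤ ε₀ * (μn / μ₂) * Real.sqrt (Γ / γ) * mnorm (M * A⁻¹ * M) ds := by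
  have hn : 0 < μn := hμ₂.trans_le hμ
  have hΓ0 : 0 < Γ := hγ.trans_le hΓ
  have hApd : A.PosDef := by
    have := PosDef.posSemidef_add hAlb ((PosDef.one (n := Fin N) (R := ℝ)).smul hγ)
    simpa using this
  have hdet : IsUnit A.det := (isUnit_iff_isUnit_det A).mp hApd.isUnit
  have he : M.mulVec (dh - ds) = A.mulVec (zt - zs) := by
    rw [mulVec_sub, mulVec_sub, hds, hdh]
  have hlow := hM.mul_dotProduct_mulVec_le_of_mulVec_eq hμ₂.le hM2 hApd.posSemidef hΓ0.le hAub he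
  have hup1 := PosSemidef.dotProduct_mulVec_le_smul hMub zs
  have hup2 := PosSemidef.smul_le_dotProduct_mulVec hAlb zs
  have hs := hApd.posSemidef.dotProduct_mulVec_nonneg_real zs
  have hms := hM.dotProduct_mulVec_nonneg_real zs
  have hme := hM.dotProduct_mulVec_nonneg_real (zt - zs)
  unfold mnorm at hz ⊢
  rw [dotProduct_mul_inv_mul_mulVec hM.isSymm_real hdet hds,
    dotProduct_mul_inv_mul_mulVec hM.isSymm_real hdet he]
  have hz2 : (zt - zs) ⬝ᵥ M.mulVec (zt - zs) ≤ ε₀ ^ 2 * (zs ⬝ᵥ M.mulVec zs) := by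
    have := pow_le_pow_left₀ (Real.sqrt_nonneg _) hz 2
    rwa [mul_pow, Real.sq_sqrt hme, Real.sq_sqrt hms] at this
  have hzs : zs ⬝ᵥ M.mulVec zs ≤ μn / γ * (zs ⬝ᵥ A.mulVec zs) := by
    rw [div_mul_eq_mul_div, le_div_iff₀ hγ]
    nlinarith [mul_le_mul_of_nonneg_left hup2 hn.le, mul_le_mul_of_nonneg_right hup1 hγ.le]
  have hratio : 1 ≤ μn / μ₂ := (one_le_div hμ₂).mpr hμ
  refine Real.sqrt_le_iff.mpr ⟨by positivity, ?_⟩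
  rw [mul_pow, mul_pow, mul_pow, Real.sq_sqrt hs, Real.sq_sqrt (by positivity)]
  calc (zt - zs) ⬝ᵥ A.mulVec (zt - zs)
      ≤ Γ / μ₂ * ((zt - zs) ⬝ᵥ M.mulVec (zt - zs)) := by
        rw [div_mul_eq_mul_div, le_div_iff₀ hμ₂]
        linarith
    _ ≤ Γ / μ₂ * (ε₀ ^ 2 * (μn / γ * (zs ⬝ᵥ A.mulVec zs))) := by gcongr; exact hz2.trans (by gcongr)
    _ = ε₀ ^ 2 * (μn / μ₂) * (Γ / γ) * (zs ⬝ᵥ A.mulVec zs) := by ring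
    _ ≤ ε₀ ^ 2 * (μn / μ₂) ^ 2 * (Γ / γ) * (zs ⬝ᵥ A.mulVec zs) := by
        gcongr
        exact le_self_pow₀ hratio two_ne_zero
end

section
/- Let M be a real symmetric positive semidefinite N×N matrix with M ⪯ μ_n I and M² ⪰ μ₂ M for constants μ_n ≥ μ₂ > 0, let A be a real symmetric N×N matrix with γI ⪯ A ⪯ ΓI for constants Γ ≥ γ > 0, and set H = M A^{−1} M. Suppose d*, d̂, d̃, z*, z̃ ∈ ℝ^N satisfy M d* = A z*, M d̂ = A z̃, ‖z̃ − z*‖_M ≤ ε₀ ‖z*‖_M, and ‖d̃ − d̂‖_M ≤ ε₀ ‖d̂‖_M for some ε₀ ≥ 0. Then ‖d̃ − d*‖_H ≤ ε ‖d*‖_H, where ε = ε₀ √((Γ/γ)(μ_n/μ₂)) · [ 1 + ε₀ (μ_n/μ₂)√(Γ/γ) + √(μ_n/μ₂) ]. -/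
open Matrix

section

variable {ι : Type*}

theorem Matrix.PosSemidef.isSymm_real_s14 {P : Matrix ι ι ℝ} (hP : P.PosSemidef) : P.IsSymm := by
  simpa [Matrix.IsHermitian, Matrix.IsSymm] using hP.1

variable [Fintype ι]

theorem dotProduct_mulVec_comm_of_isSymm {P : Matrix ι ι ℝ} (hP : P.IsSymm) (u v : ι → ℝ) :
    u ⬝ᵥ P *ᵥ v = v ⬝ᵥ P *ᵥ u := by
  rw [dotProduct_mulVec, ← mulVec_transpose, hP.eq, dotProduct_comm]

theorem Matrix.PosSemidef.dotProduct_mulVec_self_nonneg {P : Matrix ι ι ℝ} (hP : P.PosSemidef)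
    (v : ι → ℝ) : 0 ≤ v ⬝ᵥ P *ᵥ v := by
  simpa using hP.dotProduct_mulVec_nonneg v

theorem dotProduct_mulVec_le_of_posSemidef_sub {P Q : Matrix ι ι ℝ} (h : (Q - P).PosSemidef)
    (v : ι → ℝ) : v ⬝ᵥ P *ᵥ v ≤ v ⬝ᵥ Q *ᵥ v := by
  have := h.dotProduct_mulVec_self_nonneg v
  rw [sub_mulVec, dotProduct_sub] at this
  linarith

/-- A Cauchy–Schwarz type estimate: if `‖v‖_P² ≤ c ⟨u, v⟩_P` then `⟨u, v⟩_P ≤ c ‖u‖_P²`. -/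
theorem Matrix.PosSemidef.dotProduct_mulVec_le_mul {P : Matrix ι ι ℝ} (hP : P.PosSemidef)
    {c : ℝ} (hc : 0 < c) {u v : ι → ℝ} (h : v ⬝ᵥ P *ᵥ v ≤ c * (u ⬝ᵥ P *ᵥ v)) :
    u ⬝ᵥ P *ᵥ v ≤ c * (u ⬝ᵥ P *ᵥ u) := by
  have h0 := hP.dotProduct_mulVec_self_nonneg (c • u - v)
  have hs := dotProduct_mulVec_comm_of_isSymm hP.isSymm_real_s14 v u
  simp only [mulVec_sub, mulVec_smul, sub_dotProduct, dotProduct_sub, smul_dotProduct,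
    dotProduct_smul, smul_eq_mul, hs] at h0
  refine le_of_mul_le_mul_left ?_ hc
  linarith

theorem mnorm_nonneg (P : Matrix ι ι ℝ) (v : ι → ℝ) : 0 ≤ mnorm P v :=
  Real.sqrt_nonneg _

theorem mnorm_le_sqrt_mul_mnorm {P Q : Matrix ι ι ℝ} {c : ℝ} (hc : 0 ≤ c) {u v : ι → ℝ}
    (h : u ⬝ᵥ P *ᵥ u ≤ c * (v ⬝ᵥ Q *ᵥ v)) : mnorm P u ≤ √c * mnorm Q v := by
  rw [mnorm, mnorm, ← Real.sqrt_mul hc]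
  exact Real.sqrt_le_sqrt h

open scoped MatrixOrder in
theorem Matrix.PosSemidef.mnorm_add_le {P : Matrix ι ι ℝ} (hP : P.PosSemidef) (u v : ι → ℝ) :
    mnorm P (u + v) ≤ mnorm P u + mnorm P v := by
  classical
  obtain ⟨B, rfl⟩ : ∃ B : Matrix ι ι ℝ, P = Bᴴ * B :=
    
    CStarAlgebra.nonneg_iff_eq_star_mul_self.mp hP.nonneg
  have key (w : ι → ℝ) : mnorm (Bᴴ * B) w = ‖WithLp.toLp 2 (B *ᵥ w)‖ := by
    rw [mnorm, EuclideanSpace.norm_eq, ← mulVec_mulVec, dotProduct_mulVec, vecMul_conjTranspose]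
    simp [dotProduct, sq]
  simp only [key, mulVec_add, WithLp.toLp_add]
  exact norm_add_le _ _

variable [DecidableEq ι]

theorem mnorm_mul_inv_mul_eq {M A : Matrix ι ι ℝ} (hM : M.IsSymm) (hA : IsUnit A.det)
    {x z : ι → ℝ} (h : M *ᵥ x = A *ᵥ z) : mnorm (M * A⁻¹ * M) x = mnorm A z := by
  have hz : A⁻¹ *ᵥ A *ᵥ z = z := by rw [mulVec_mulVec, nonsing_inv_mul A hA, one_mulVec]
  rw [mnorm, mnorm, ← mulVec_mulVec, ← mulVec_mulVec, h, hz,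
    dotProduct_mulVec_comm_of_isSymm hM, h]

end

theorem newton_direction_approximation_bound
    {N : ℕ} (M A : Matrix (Fin N) (Fin N) ℝ) (μn μ₂ γ Γ ε₀ : ℝ)
    (hμ₂ : 0 < μ₂) (hμ : μ₂ ≤ μn) (hγ : 0 < γ) (hΓ : γ ≤ Γ) (hε₀ : 0 ≤ ε₀)
    (hM : M.PosSemidef)
    (hMub : (μn • (1 : Matrix (Fin N) (Fin N) ℝ) - M).PosSemidef)
    (hM2 : (M * M - μ₂ • M).PosSemidef)
    (hA : A.IsSymm)
    (hAlb : (A - γ • (1 : Matrix (Fin N) (Fin N) ℝ)).PosSemidef)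
    (hAub : (Γ • (1 : Matrix (Fin N) (Fin N) ℝ) - A).PosSemidef)
    (ds dh dt zs zt : Fin N → ℝ)
    (hds : M.mulVec ds = A.mulVec zs)
    (hdh : M.mulVec dh = A.mulVec zt)
    (hz : mnorm M (zt - zs) ≤ ε₀ * mnorm M zs)
    (hd : mnorm M (dt - dh) ≤ ε₀ * mnorm M dh) :
    mnorm (M * A⁻¹ * M) (dt - ds)
      ≤ ε₀ * Real.sqrt ((Γ / γ) * (μn / μ₂))
          * (1 + ε₀ * (μn / μ₂) * Real.sqrt (Γ / γ) + Real.sqrt (μn / μ₂))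
          * mnorm (M * A⁻¹ * M) ds := by
  have hμn : 0 < μn := hμ₂.trans_le hμ
  have hΓ₀ : 0 < Γ := hγ.trans_le hΓ
  have hMs : M.IsSymm := hM.isSymm_real_s14
  have hApd : A.PosDef := by
    simpa using (PosDef.one.smul hγ).add_posSemidef hAlb
  have hdet : IsUnit A.det := hApd.det_pos.ne'.isUnit
  have hMle (v : Fin N → ℝ) : v ⬝ᵥ M *ᵥ v ≤ μn * (v ⬝ᵥ v) := by
    simpa [smul_mulVec] using dotProduct_mulVec_le_of_posSemidef_sub hMub v
  have hleA (v : Fin N → ℝ) : γ * (v ⬝ᵥ v) ≤ v ⬝ᵥ A *ᵥ v := by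
    simpa [smul_mulVec] using dotProduct_mulVec_le_of_posSemidef_sub hAlb v
  have hAle (v : Fin N → ℝ) : v ⬝ᵥ A *ᵥ v ≤ Γ * (v ⬝ᵥ v) := by
    simpa [smul_mulVec] using dotProduct_mulVec_le_of_posSemidef_sub hAub v
  have hMM (v : Fin N → ℝ) : μ₂ * (v ⬝ᵥ M *ᵥ v) ≤ M *ᵥ v ⬝ᵥ M *ᵥ v := by
    have h := dotProduct_mulVec_le_of_posSemidef_sub hM2 v
    rwa [← mulVec_mulVec, dotProduct_mulVec_comm_of_isSymm hMs v, smul_mulVec,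
      dotProduct_smul, smul_eq_mul] at h
  have hAA (v : Fin N → ℝ) : A *ᵥ v ⬝ᵥ A *ᵥ v ≤ Γ * (v ⬝ᵥ A *ᵥ v) := by
    have hs := dotProduct_mulVec_comm_of_isSymm hA v (A *ᵥ v)
    rw [← hs]
    refine hApd.posSemidef.dotProduct_mulVec_le_mul hΓ₀ ?_
    rw [hs]
    exact hAle _
  have hMA (z : Fin N → ℝ) : z ⬝ᵥ M *ᵥ z ≤ μn / γ * (z ⬝ᵥ A *ᵥ z) := by
    rw [div_mul_eq_mul_div, le_div_iff₀ hγ]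
    nlinarith [hMle z, hleA z]
  have hx {x z : Fin N → ℝ} (h : M *ᵥ x = A *ᵥ z) :
      x ⬝ᵥ M *ᵥ x ≤ Γ / μ₂ * (z ⬝ᵥ A *ᵥ z) := by
    rw [div_mul_eq_mul_div, le_div_iff₀ hμ₂, mul_comm]
    refine (hMM x).trans ?_
    rw [h]
    exact hAA z
  have hzM {x z : Fin N → ℝ} (h : M *ᵥ x = A *ᵥ z) :
      z ⬝ᵥ A *ᵥ z ≤ Γ / μ₂ * (z ⬝ᵥ M *ᵥ z) := by
    have := hM.dotProduct_mulVec_le_mul (u := z) (v := x) (div_pos hΓ₀ hμ₂)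
    rw [h] at this
    exact this (h ▸ hx h)
  have hzx {x z : Fin N → ℝ} (h : M *ᵥ x = A *ᵥ z) :
      z ⬝ᵥ A *ᵥ z ≤ μn / γ * (x ⬝ᵥ M *ᵥ x) := by
    have := hM.dotProduct_mulVec_le_mul (u := x) (v := z) (div_pos hμn hγ)
    have hxz : x ⬝ᵥ M *ᵥ z = z ⬝ᵥ A *ᵥ z := by rw [dotProduct_mulVec_comm_of_isSymm hMs, h]
    rw [hxz] at this
    exact this (hMA z)
  have hc₁ : 0 ≤ Γ / μ₂ := by positivity
  have hc₂ : 0 ≤ μn / γ := by positivity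
  set K := √(Γ / γ * (μn / μ₂)) with hK
  have hKmul : √(Γ / μ₂) * √(μn / γ) = K := by
    rw [hK, ← Real.sqrt_mul hc₁]
    congr 1
    field_simp
  have hHs := mnorm_mul_inv_mul_eq hMs hdet hds
  have hHh := mnorm_mul_inv_mul_eq hMs hdet hdh
  have hsub : M *ᵥ (dh - ds) = A *ᵥ (zt - zs) := by rw [mulVec_sub, mulVec_sub, hds, hdh]
  have hHsub := mnorm_mul_inv_mul_eq hMs hdet hsub
  have hut : M *ᵥ (dt - dh) = A *ᵥ (A⁻¹ *ᵥ M *ᵥ (dt - dh)) := by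
    rw [mulVec_mulVec _ A, mul_nonsing_inv A hdet, one_mulVec]
  have hHut := mnorm_mul_inv_mul_eq hMs hdet hut
  have hHpsd : (M * A⁻¹ * M).PosSemidef := by
    have := hApd.inv.posSemidef.conjTranspose_mul_mul_same M
    rwa [hM.1.eq] at this
  set H := M * A⁻¹ * M
  have hstep₁ : mnorm H (dh - ds) ≤ ε₀ * K * mnorm H ds := by
    calc mnorm H (dh - ds) ≤ √(Γ / μ₂) * mnorm M (zt - zs) :=
          hHsub ▸ mnorm_le_sqrt_mul_mnorm hc₁ (hzM hsub)
      _ ≤ √(Γ / μ₂) * (ε₀ * (√(μn / γ) * mnorm A zs)) := by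
          gcongr
          refine hz.trans ?_
          gcongr
          exact mnorm_le_sqrt_mul_mnorm hc₂ (hMA zs)
      _ = ε₀ * K * mnorm H ds := by rw [hHs, ← hKmul]; ring
  have hstep₂ : mnorm H (dt - dh) ≤ ε₀ * K * mnorm H dh := by
    calc mnorm H (dt - dh) ≤ √(μn / γ) * mnorm M (dt - dh) :=
          hHut ▸ mnorm_le_sqrt_mul_mnorm hc₂ (hzx hut)
      _ ≤ √(μn / γ) * (ε₀ * (√(Γ / μ₂) * mnorm A zt)) := by
          gcongr
          refine hd.trans ?_
          gcongr
          exact mnorm_le_sqrt_mul_mnorm hc₁ (hx hdh)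
      _ = ε₀ * K * mnorm H dh := by rw [hHh, ← hKmul]; ring
  have htri₁ : mnorm H dh ≤ mnorm H (dh - ds) + mnorm H ds := by
    simpa using hHpsd.mnorm_add_le (dh - ds) ds
  have htri₂ : mnorm H (dt - ds) ≤ mnorm H (dt - dh) + mnorm H (dh - ds) := by
    simpa using hHpsd.mnorm_add_le (dt - dh) (dh - ds)
  have hκ : 1 ≤ μn / μ₂ := (one_le_div hμ₂).mpr hμ
  have hκs : 1 ≤ √(μn / μ₂) := Real.one_le_sqrt.mpr hκ
  have hKle : K ≤ μn / μ₂ * √(Γ / γ) := by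
    rw [hK, mul_comm, Real.sqrt_mul (by positivity)]
    gcongr
    exact Real.sqrt_le_self_iff.mpr (.inr hκ)
  have hε : 0 ≤ ε₀ * K := by positivity
  have hn := mnorm_nonneg H ds
  calc mnorm H (dt - ds) ≤ ε₀ * K * (ε₀ * K * mnorm H ds + mnorm H ds)
        + ε₀ * K * mnorm H ds := by
        refine htri₂.trans (add_le_add (hstep₂.trans ?_) hstep₁)
        gcongr
        exact htri₁.trans (by gcongr)
    _ = ε₀ * K * (1 + ε₀ * K + 1) * mnorm H ds := by ring
    _ ≤ ε₀ * K * (1 + ε₀ * (μn / μ₂ * √(Γ / γ)) + √(μn / μ₂)) * mnorm H ds := by gcongr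
    _ = _ := by ring
end

section
/- Let M be a real symmetric positive semidefinite N×N matrix satisfying vᵀ M v ≥ μ₂ ‖v‖₂² for every v orthogonal to ker M (μ₂ > 0), and let A be a real symmetric positive definite N×N matrix with A ⪯ ΓI (Γ > 0). Then the matrix H = M A^{−1} M satisfies H² ⪰ (μ₂²/Γ) H. -/
open Matrix

/-- The splitting of a vector along the kernel of a real matrix and its orthogonal complement. -/
theorem exists_add_orthogonal_ker_mulVec {n : Type*} [Fintype n] (M : Matrix n n ℝ) (w : n → ℝ) :
    ∃ p k : n → ℝ, w = p + k ∧ M *ᵥ k = 0 ∧ ∀ z, M *ᵥ z = 0 → p ⬝ᵥ z = 0 := by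
  classical
  let K : Submodule ℝ (EuclideanSpace ℝ n) := LinearMap.ker (Matrix.toEuclideanLin M)
  obtain ⟨k, hk, p, hp, h⟩ := K.exists_add_mem_mem_orthogonal (WithLp.toLp 2 w)
  refine ⟨p.ofLp, k.ofLp, ?_, ?_, fun z hz => ?_⟩
  · rw [add_comm]
    exact congrArg WithLp.ofLp h
  · exact congrArg WithLp.ofLp (LinearMap.mem_ker.1 hk)
  · have hzK : WithLp.toLp 2 z ∈ K := LinearMap.mem_ker.2 (congrArg (WithLp.toLp 2) hz)
    have := (Submodule.mem_orthogonal K p).1 hp _ hzK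
    simpa [EuclideanSpace.inner_eq_star_dotProduct] using this

theorem dotProduct_sq_le {n : Type*} [Fintype n] (u v : n → ℝ) :
    (u ⬝ᵥ v) ^ 2 ≤ (u ⬝ᵥ u) * (v ⬝ᵥ v) := by
  simpa [dotProduct, sq] using Finset.sum_mul_sq_le_sq_mul_sq Finset.univ u v

theorem Matrix.IsHermitian.dotProduct_mulVec_comm {n : Type*} [Fintype n] {M : Matrix n n ℝ}
    (hM : M.IsHermitian) (x y : n → ℝ) : x ⬝ᵥ M *ᵥ y = M *ᵥ x ⬝ᵥ y := by
  rw [dotProduct_mulVec, ← mulVec_transpose, ← conjTranspose_eq_transpose_of_trivial, hM.eq]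

/-- `A² ⪯ Γ A` for a positive semidefinite matrix `A ⪯ Γ I`, as quadratic forms. -/
theorem Matrix.PosSemidef.mulVec_dotProduct_mulVec_le_s19 {n : Type*} [Fintype n] [DecidableEq n]
    {A : Matrix n n ℝ} {Γ : ℝ} (hΓ : 0 < Γ) (hA : A.PosSemidef)
    (hAub : (Γ • (1 : Matrix n n ℝ) - A).PosSemidef) (w : n → ℝ) :
    A *ᵥ w ⬝ᵥ A *ᵥ w ≤ Γ * (w ⬝ᵥ A *ᵥ w) := by
  have h₁ := hA.dotProduct_mulVec_nonneg (Γ • w - A *ᵥ w)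
  have h₂ := hAub.dotProduct_mulVec_nonneg (A *ᵥ w)
  have h₃ := hA.isHermitian.dotProduct_mulVec_comm w (A *ᵥ w)
  simp only [star_trivial, mulVec_sub, mulVec_smul, sub_mulVec, smul_mulVec, one_mulVec,
    sub_dotProduct, dotProduct_sub, smul_dotProduct, dotProduct_smul, smul_eq_mul, h₃] at h₁ h₂
  have h₄ : 0 ≤ Γ * (Γ * (w ⬝ᵥ A *ᵥ w) - A *ᵥ w ⬝ᵥ A *ᵥ w) := by linarith
  linarith [nonneg_of_mul_nonneg_right h₄ hΓ]

/-- If `M` is bounded below by `μ` on `(ker M)ᗮ`, then `‖M w‖ ≥ μ ‖P w‖` for the orthogonal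
projection `P` onto the range of `M`, tested against `M x`. -/
theorem Matrix.IsHermitian.sq_mul_dotProduct_sq_le {n : Type*} [Fintype n] {M : Matrix n n ℝ}
    {μ : ℝ} (hμ : 0 ≤ μ) (hM : M.IsHermitian)
    (hMlb : ∀ v : n → ℝ, (∀ w : n → ℝ, M *ᵥ w = 0 → v ⬝ᵥ w = 0) →
      μ * (∑ i, v i ^ 2) ≤ v ⬝ᵥ M *ᵥ v) (x w : n → ℝ) :
    μ ^ 2 * (M *ᵥ x ⬝ᵥ w) ^ 2 ≤ (M *ᵥ x ⬝ᵥ M *ᵥ x) * (M *ᵥ w ⬝ᵥ M *ᵥ w) := by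
  obtain ⟨p, k, rfl, hk, hp⟩ := exists_add_orthogonal_ker_mulVec M w
  have hxk : M *ᵥ x ⬝ᵥ k = 0 := by rw [← hM.dotProduct_mulVec_comm, hk, dotProduct_zero]
  rw [dotProduct_add, hxk, add_zero, mulVec_add, hk, add_zero]
  have hlb : μ * (p ⬝ᵥ p) ≤ p ⬝ᵥ M *ᵥ p := by simpa [dotProduct, sq] using hMlb p hp
  have hpp : 0 ≤ p ⬝ᵥ p := by simpa using dotProduct_star_self_nonneg p
  have hxx : 0 ≤ M *ᵥ x ⬝ᵥ M *ᵥ x := by simpa using dotProduct_star_self_nonneg (M *ᵥ x)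
  have hMp : 0 ≤ M *ᵥ p ⬝ᵥ M *ᵥ p := by simpa using dotProduct_star_self_nonneg (M *ᵥ p)
  have hbound : μ ^ 2 * (p ⬝ᵥ p) ≤ M *ᵥ p ⬝ᵥ M *ᵥ p := by
    rcases hpp.eq_or_lt with h | h
    · simpa [← h] using hMp
    · refine le_of_mul_le_mul_left ?_ h
      calc (p ⬝ᵥ p) * (μ ^ 2 * (p ⬝ᵥ p)) = (μ * (p ⬝ᵥ p)) ^ 2 := by ring
        _ ≤ (p ⬝ᵥ M *ᵥ p) ^ 2 := by gcongr
        _ ≤ _ := dotProduct_sq_le _ _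
  calc μ ^ 2 * (M *ᵥ x ⬝ᵥ p) ^ 2 ≤ μ ^ 2 * ((M *ᵥ x ⬝ᵥ M *ᵥ x) * (p ⬝ᵥ p)) := by
        gcongr
        exact dotProduct_sq_le _ _
    _ = (M *ᵥ x ⬝ᵥ M *ᵥ x) * (μ ^ 2 * (p ⬝ᵥ p)) := by ring
    _ ≤ _ := by gcongr

theorem H_sq_ge_smul_H
    {N : ℕ} (M A : Matrix (Fin N) (Fin N) ℝ) (μ₂ Γ : ℝ)
    (hμ₂ : 0 < μ₂) (hΓ : 0 < Γ)
    (hM : M.PosSemidef)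
    (hMlb : ∀ v : Fin N → ℝ, (∀ w : Fin N → ℝ, M.mulVec w = 0 → v ⬝ᵥ w = 0) →
      μ₂ * (∑ i, v i ^ 2) ≤ v ⬝ᵥ M.mulVec v)
    (hA : A.PosDef)
    (hAub : (Γ • (1 : Matrix (Fin N) (Fin N) ℝ) - A).PosSemidef) :
    ((M * A⁻¹ * M) * (M * A⁻¹ * M) - (μ₂ ^ 2 / Γ) • (M * A⁻¹ * M)).PosSemidef := by
  have hH : (M * A⁻¹ * M).IsHermitian := by
    have := isHermitian_conjTranspose_mul_mul M hA.inv.isHermitian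
    rwa [hM.isHermitian.eq] at this
  refine .of_dotProduct_mulVec_nonneg (.sub ?_ ?_) fun x => ?_
  · rw [IsHermitian, conjTranspose_mul, hH.eq]
  · rw [IsHermitian, conjTranspose_smul, hH.eq, star_trivial]
  set w := A⁻¹ *ᵥ M *ᵥ x with hw
  have hHx : (M * A⁻¹ * M) *ᵥ x = M *ᵥ w := by simp only [hw, mulVec_mulVec, Matrix.mul_assoc]
  have hAw : A *ᵥ w = M *ᵥ x := by
    rw [hw, mulVec_mulVec, mul_nonsing_inv _ ((isUnit_iff_isUnit_det A).1 hA.isUnit), one_mulVec]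
  rw [star_trivial, sub_mulVec, dotProduct_sub, smul_mulVec, dotProduct_smul, ← mulVec_mulVec,
    hH.dotProduct_mulVec_comm, hHx, hM.isHermitian.dotProduct_mulVec_comm x w, smul_eq_mul,
    sub_nonneg]
  have h₁ := hA.posSemidef.mulVec_dotProduct_mulVec_le_s19 hΓ hAub w
  have h₂ := hM.isHermitian.sq_mul_dotProduct_sq_le hμ₂.le hMlb x w
  rw [hAw, dotProduct_comm w] at h₁
  have hxx : 0 ≤ M *ᵥ x ⬝ᵥ M *ᵥ x := by simpa using dotProduct_star_self_nonneg (M *ᵥ x)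
  have hww : 0 ≤ M *ᵥ w ⬝ᵥ M *ᵥ w := by simpa using dotProduct_star_self_nonneg (M *ᵥ w)
  rw [div_mul_eq_mul_div, div_le_iff₀ hΓ]
  have ht : 0 ≤ M *ᵥ x ⬝ᵥ w := nonneg_of_mul_nonneg_right (hxx.trans h₁) hΓ
  rcases ht.eq_or_lt with h | h
  · rw [← h, mul_zero]
    positivity
  · refine le_of_mul_le_mul_right ?_ h
    calc μ₂ ^ 2 * (M *ᵥ x ⬝ᵥ w) * (M *ᵥ x ⬝ᵥ w) = μ₂ ^ 2 * (M *ᵥ x ⬝ᵥ w) ^ 2 := by ring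
      _ ≤ _ := h₂
      _ ≤ Γ * (M *ᵥ x ⬝ᵥ w) * (M *ᵥ w ⬝ᵥ M *ᵥ w) := by gcongr
      _ = _ := by ring
end
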